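/- Let f(t,s,r)=γ(t)+sX(t)+rY(t) be a pseudo-non-degenerate two-ruled frontal in ℝ⁴ (normalized, with functions a,b₁,b₂,b₃, b₄≡0, δ=−det(X,Y,X',X'')). Let p=(0,s,r) be a singular point (so b₃(0)+s+ra(0)=0) and assume f is a front at p, i.e. δ(0)≠0. Then f at p is a cuspidal edge (A-equivalent to (t,s,r)↦(t,s,r²,r³)) if and only if ra'(0)−a(0)b₂(0)−b₁(0)+b₃'(0)≠0. -/

import Mathlib

open scoped Topology
open Filter

noncomputable section

/-- Ambient space `ℝ⁴`. -/
abbrev E4 := Fin 4 → ℝ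

/-- The standard inner product on `ℝ⁴`. -/
def dot4 (u v : E4) : ℝ := ∑ i, u i * v i

/-- `det(u,v,w,x)` for four vectors of `ℝ⁴`. -/
def det4 (u v w x : E4) : ℝ := Matrix.det (Matrix.of ![u, v, w, x])

/-- The triple exterior (cross) product `u ∧ v ∧ w` in `ℝ⁴`. -/
def tcross (u v w : E4) : E4 := fun i => det4 (Pi.single i 1) u v w

/-- A diffeomorphism-germ at `p`: smooth at `p` with invertible differential. -/
def IsDiffeoGermAt {E : Type*} [NormedAddCommGroup E] [NormedSpace ℝ E]
    (φ : E → E) (p : E) : Prop :=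
  ContDiffAt ℝ (⊤ : ℕ∞) φ p ∧ Function.Bijective (fderiv ℝ φ p)

/-- `f` at `p` is 𝒜-equivalent to the germ of `g` at `0`. -/
def AEquivAt (f : ℝ × ℝ × ℝ → E4) (p : ℝ × ℝ × ℝ) (g : ℝ × ℝ × ℝ → E4) : Prop :=
  ∃ (φ : ℝ × ℝ × ℝ → ℝ × ℝ × ℝ) (Φ : E4 → E4),
    IsDiffeoGermAt φ p ∧ IsDiffeoGermAt Φ (f p) ∧
    φ p = 0 ∧ Φ (f p) = g 0 ∧ ∀ᶠ q in 𝓝 p, Φ (f q) = g (φ q)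

section
open scoped Topology ContDiff
open Filter MeasureTheory

/-- smooth with all derivatives bounded -/
def BD {E F : Type*} [NormedAddCommGroup E] [NormedSpace ℝ E] [NormedAddCommGroup F]
    [NormedSpace ℝ F] (f : E → F) : Prop :=
  ContDiff ℝ ∞ f ∧ ∀ n : ℕ, ∃ M : ℝ, ∀ x, ‖iteratedFDeriv ℝ n f x‖ ≤ M

section
variable {E V F α : Type*} [NormedAddCommGroup E] [NormedSpace ℝ E] [NormedAddCommGroup F]
    [NormedSpace ℝ F] [NormedAddCommGroup V] [NormedSpace ℝ V]

lemma BD.comp_clm {f : V → F} (hf : BD f) (L : E →L[ℝ] V) : BD (fun x => f (L x)) := by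
  refine ⟨hf.1.comp L.contDiff, fun n => ?_⟩
  obtain ⟨M, hM⟩ := hf.2 n
  refine ⟨M * ∏ _i : Fin n, ‖L‖, fun x => ?_⟩
  have := L.iteratedFDeriv_comp_right (f := f) (hf.1) x (i := n) (by exact_mod_cast le_top)
  change ‖iteratedFDeriv ℝ n (f ∘ L) x‖ ≤ _
  rw [this]
  refine (ContinuousMultilinearMap.norm_compContinuousLinearMap_le _ _).trans ?_
  gcongr
  exact hM _

lemma BD.mul {f g : E → ℂ} (hf : BD f) (hg : BD g) : BD (fun x => f x * g x) := by
  refine ⟨hf.1.mul hg.1, fun n => ?_⟩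
  choose M hM using hf.2
  choose M' hM' using hg.2
  refine ⟨∑ i ∈ Finset.range (n+1), (n.choose i : ℝ) * M i * M' (n - i), fun x => ?_⟩
  refine (norm_iteratedFDeriv_mul_le hf.1 hg.1 x (n := n) (by exact_mod_cast le_top)).trans ?_
  have h0 : ∀ i, 0 ≤ M i := fun i => (norm_nonneg _).trans (hM i x)
  gcongr with i hi
  · exact mul_nonneg (by positivity) (h0 _)
  · exact hM _ _
  · exact hM' _ _

variable [TopologicalSpace α] [SecondCountableTopology α] [MeasurableSpace α]
  [BorelSpace α] (μ : Measure α)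

theorem BD.integral {Ψ : V → ℂ} (hΨ : BD Ψ)
    {d : α → ℂ} (hd : Continuous d) {L : α → E →L[ℝ] V} (hL : Continuous L)
    (hdInt : ∀ n : ℕ, Integrable (fun a => ‖d a‖ * ‖L a‖ ^ n) μ) :
    BD (fun e => ∫ a, d a * Ψ (L a e) ∂μ) := by
  choose M hM using hΨ.2
  have hsm : ∀ a, ContDiff ℝ ∞ (fun e => d a * Ψ (L a e)) := fun a =>
    contDiff_const.mul (hΨ.1.comp (L a).contDiff)
  set q : ∀ n : ℕ, E → α → ContinuousMultilinearMap ℝ (fun _ : Fin n => E) ℂ :=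
    fun n e a => iteratedFDeriv ℝ n (fun e => d a * Ψ (L a e)) e with hq
  have hqe : ∀ n e a, q n e a =
      d a • (iteratedFDeriv ℝ n Ψ (L a e)).compContinuousLinearMap (fun _ => L a) := by
    intro n e a
    simp only [hq]
    have h1 := (L a).iteratedFDeriv_comp_right (f := Ψ) (hΨ.1) e (i := n)
      (by exact_mod_cast le_top)
    rw [← h1, ← iteratedFDeriv_const_smul_apply]
    · rfl
    · exact ((hΨ.1.comp (L a).contDiff).of_le (by exact_mod_cast le_top)).contDiffAt
  have hqb : ∀ n e a, ‖q n e a‖ ≤ M n * (‖d a‖ * ‖L a‖ ^ n) := by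
    intro n e a
    rw [hqe, norm_smul]
    have h2 := ContinuousMultilinearMap.norm_compContinuousLinearMap_le
      (iteratedFDeriv ℝ n Ψ (L a e)) (fun _ => L a)
    rw [Finset.prod_const, Finset.card_univ, Fintype.card_fin] at h2
    calc _ ≤ ‖d a‖ * (M n * ‖L a‖ ^ n) := by
          gcongr
          refine h2.trans ?_
          gcongr
          exact hM _ _
      _ = _ := by ring
  have hqc : ∀ n e, Continuous (q n e) := by
    intro n e
    have : q n e = fun a =>
      d a • (iteratedFDeriv ℝ n Ψ (L a e)).compContinuousLinearMap (fun _ => L a) := by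
      ext1 a; exact hqe n e a
    rw [this]
    refine hd.smul ?_
    have h3 : Continuous (fun a => iteratedFDeriv ℝ n Ψ (L a e)) :=
      (hΨ.1.continuous_iteratedFDeriv (m := n) (by exact_mod_cast le_top)).comp
        (hL.clm_apply continuous_const)
    have h5 : Continuous (fun a => ContinuousMultilinearMap.compContinuousLinearMapContinuousMultilinear
        ℝ (fun _ : Fin n => E) (fun _ : Fin n => V) ℂ (fun _ => L a)) :=
      (ContinuousMultilinearMap.cont _).comp (continuous_pi fun _ => hL)
    exact h5.clm_apply h3
  have hqd : ∀ n e a, HasFDerivAt (fun e => q n e a) ((q (n+1) e a).curryLeft) e := by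
    intro n e a
    exact ((contDiff_iff_ftaylorSeries.1 (hsm a)).fderiv n (by exact_mod_cast ENat.natCast_lt_top n) e)
  have hqi : ∀ n e, Integrable (q n e) μ := fun n e =>
    ((hdInt n).const_mul (M n)).mono' (hqc n e).aestronglyMeasurable
      (Eventually.of_forall fun a => hqb n e a)
  have key : HasFTaylorSeriesUpTo ∞ (fun e => ∫ a, d a * Ψ (L a e) ∂μ)
      (fun e n => ∫ a, q n e a ∂μ) := by
    constructor
    · intro e
      have := (continuousMultilinearCurryFin0 ℝ E ℂ).toContinuousLinearEquiv.toContinuousLinearMap.integral_comp_comm (hqi 0 e)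
      exact this.symm
    · intro n _ e
      let Λ : (E [×n+1]→L[ℝ] ℂ) →L[ℝ] (E →L[ℝ] E [×n]→L[ℝ] ℂ) :=
        (continuousMultilinearCurryLeftEquiv ℝ (fun _ : Fin (n+1) => E) ℂ).toContinuousLinearEquiv.toContinuousLinearMap
      have := ContinuousLinearMap.integral_comp_comm (𝕜 := ℝ) (E := E [×n+1]→L[ℝ] ℂ)
        (Fₗ := E →L[ℝ] E [×n]→L[ℝ] ℂ) Λ (hqi (n+1) e)
      have h4 : (∫ a, q (n+1) e a ∂μ).curryLeft = ∫ a, (q (n+1) e a).curryLeft ∂μ := this.symm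
      change HasFDerivAt (fun e => ∫ a, q n e a ∂μ) (∫ a, q (n+1) e a ∂μ).curryLeft e
      rw [h4]
      refine hasFDerivAt_integral_of_dominated_of_fderiv_le (s := Set.univ) (F := fun e a => q n e a)
        (F' := fun e a => (q (n+1) e a).curryLeft) (bound := fun a => M (n+1) * (‖d a‖ * ‖L a‖ ^ (n+1)))
        univ_mem ?_ (hqi n e) ?_ ?_ ((hdInt (n+1)).const_mul _) ?_
      · exact Eventually.of_forall fun e => (hqc n e).aestronglyMeasurable
      · exact ((continuousMultilinearCurryLeftEquiv ℝ (fun _ : Fin (n+1) => E) ℂ).continuous.comp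
          (hqc (n+1) e)).aestronglyMeasurable
      · refine Eventually.of_forall fun a x _ => ?_
        rw [ContinuousMultilinearMap.curryLeft_norm]
        exact hqb _ _ _
      · exact Eventually.of_forall fun a x _ => hqd n x a
    · intro n _
      refine continuous_of_dominated (bound := fun a => M n * (‖d a‖ * ‖L a‖ ^ n))
        (fun e => (hqc n e).aestronglyMeasurable) (fun e => Eventually.of_forall fun a => hqb n e a)
        ((hdInt n).const_mul _) (Eventually.of_forall fun a => ?_)
      exact (hsm a).continuous_iteratedFDeriv (m := n) (by exact_mod_cast le_top)
  refine ⟨contDiff_iff_ftaylorSeries.2 ?_, fun n => ⟨∫ a, M n * (‖d a‖ * ‖L a‖ ^ n) ∂μ, fun x => ?_⟩⟩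
  · exact contDiff_iff_ftaylorSeries.1 key.contDiff
  · rw [← key.eq_iteratedFDeriv (m := n) (by exact_mod_cast le_top)]
    exact norm_integral_le_of_norm_le ((hdInt n).const_mul _)
      (Eventually.of_forall fun a => hqb n x a)
end

section
/-- auxiliary coefficients -/
noncomputable def cosCoef (n : ℕ) : ℝ := (-1) ^ n / ((2 * n).factorial : ℝ)

lemma exists_cosSqrt : ∃ C : ℝ → ℝ, ContDiff ℝ ∞ C ∧ ∀ w, C (w ^ 2) = Real.cos w := by
  have hr : (FormalMultilinearSeries.ofScalars ℝ cosCoef).radius = ⊤ := by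
    refine FormalMultilinearSeries.ofScalars_radius_eq_top_of_tendsto ℝ cosCoef
      (Eventually.of_forall fun n => ?_) ?_
    · unfold cosCoef
      positivity
    · have h : ∀ n : ℕ, ‖cosCoef n.succ‖ / ‖cosCoef n‖ = 1 / ((2 * n + 1) * (2 * n + 2) : ℝ) := by
        intro n
        have h1 : ((2 * (n + 1)).factorial : ℝ) = (2 * n + 2) * (2 * n + 1) * (2 * n).factorial := by
          rw [show 2 * (n + 1) = 2 * n + 1 + 1 by ring, Nat.factorial_succ, Nat.factorial_succ]
          push_cast; ring
        have h2 : ((2 * n).factorial : ℝ) ≠ 0 := by positivity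
        simp only [cosCoef, norm_div, norm_pow, norm_neg, norm_one, one_pow, Nat.succ_eq_add_one, h1,
          Real.norm_natCast, norm_mul]
        rw [Real.norm_of_nonneg (by positivity), Real.norm_of_nonneg (by positivity)]
        field_simp
      refine squeeze_zero (g := fun n : ℕ => 1 / ((n : ℝ) + 1)) (fun n => by positivity) (fun n => ?_)
        tendsto_one_div_add_atTop_nhds_zero_nat
      rw [h]
      apply one_div_le_one_div_of_le (by positivity)
      nlinarith [(Nat.cast_nonneg n : (0:ℝ) ≤ n)]
  have hp := (FormalMultilinearSeries.ofScalars ℝ cosCoef).hasFPowerSeriesOnBall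
    (by rw [hr]; exact ENNReal.zero_lt_top)
  refine ⟨(FormalMultilinearSeries.ofScalars ℝ cosCoef).sum, ?_, fun w => ?_⟩
  · have h : AnalyticOnNhd ℝ (FormalMultilinearSeries.ofScalars ℝ cosCoef).sum Set.univ := by
      have := hp.analyticOnNhd
      rw [hr] at this
      simpa using this
    exact contDiffOn_univ.1 (h.contDiffOn uniqueDiffOn_univ)
  · have := FormalMultilinearSeries.ofScalars_sum_eq cosCoef (w ^ 2)
    unfold FormalMultilinearSeries.ofScalarsSum at this
    rw [this]
    rw [← (Real.hasSum_cos w).tsum_eq]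
    congr 1; ext n
    simp only [cosCoef, smul_eq_mul, ← pow_mul]
    ring

lemma cosSqrt_bound {C : ℝ → ℝ} (hC : ContDiff ℝ ∞ C) (h : ∀ w, C (w ^ 2) = Real.cos w) (k : ℕ) :
    ∃ M : ℝ, ∀ z, 1 ≤ z → |iteratedDeriv k C z| ≤ M := by
  have hD : ∀ k z, HasDerivAt (iteratedDeriv k C) (iteratedDeriv (k + 1) C z) z := by
    intro k z
    rw [iteratedDeriv_succ]
    refine (hC.differentiable_iteratedDeriv k ?_ z).hasDerivAt
    exact_mod_cast ENat.natCast_lt_top k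
  have h1 : ∀ w, 2 * w * iteratedDeriv 1 C (w ^ 2) = - Real.sin w := by
    intro w
    have e1 : HasDerivAt (fun w => C (w ^ 2)) (iteratedDeriv 1 C (w ^ 2) * (2 * w)) w := by
      have := hD 0 (w ^ 2)
      rw [iteratedDeriv_zero] at this
      have h2 : HasDerivAt (fun w : ℝ => w ^ 2) (2 * w) w := by simpa using hasDerivAt_pow 2 w
      exact HasDerivAt.comp (h := fun w : ℝ => w ^ 2) w this h2
    have e2 : HasDerivAt (fun w => C (w ^ 2)) (- Real.sin w) w := by
      rw [funext h]; exact Real.hasDerivAt_cos w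
    rw [← e1.unique e2]; ring
  have h2 : ∀ w, 4 * w ^ 2 * iteratedDeriv 2 C (w ^ 2) + 2 * iteratedDeriv 1 C (w ^ 2) + C (w ^ 2) = 0 := by
    intro w
    have h2 : HasDerivAt (fun w : ℝ => w ^ 2) (2 * w) w := by simpa using hasDerivAt_pow 2 w
    have e0 : HasDerivAt (fun w : ℝ => 2 * w) 2 w := by simpa using (hasDerivAt_id w).const_mul 2
    have e1 : HasDerivAt (fun w => 2 * w * iteratedDeriv 1 C (w ^ 2))
        (2 * iteratedDeriv 1 C (w ^ 2) + 2 * w * (iteratedDeriv 2 C (w ^ 2) * (2 * w))) w :=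
      e0.mul (HasDerivAt.comp (h := fun w : ℝ => w ^ 2) w (hD 1 (w ^ 2)) h2)
    have e2 : HasDerivAt (fun w => 2 * w * iteratedDeriv 1 C (w ^ 2)) (- Real.cos w) w := by
      rw [funext h1]; exact (Real.hasDerivAt_sin w).neg
    have := e1.unique e2
    rw [h]; linarith
  have h3 : ∀ k : ℕ, ∀ z, 0 < z → 4 * z * iteratedDeriv (k + 2) C z +
      (4 * k + 2) * iteratedDeriv (k + 1) C z + iteratedDeriv k C z = 0 := by
    intro k
    induction k with
    | zero =>
      intro z hz
      have := h2 (Real.sqrt z)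
      rw [Real.sq_sqrt hz.le] at this
      simpa using this
    | succ k ih =>
      intro z hz
      have e0 : HasDerivAt (fun z : ℝ => 4 * z) 4 z := by simpa using (hasDerivAt_id z).const_mul 4
      have e1 := ((e0.mul (hD (k + 2) z)).add ((hD (k + 1) z).const_mul (4 * k + 2 : ℝ))).add (hD k z)
      have e2 : HasDerivAt (fun z => (0:ℝ)) 0 z := hasDerivAt_const _ _
      have e3 := e2.congr_of_eventuallyEq (f₁ := fun z => 4 * z * iteratedDeriv (k + 2) C z +
        (4 * k + 2) * iteratedDeriv (k + 1) C z + iteratedDeriv k C z)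
        ((lt_mem_nhds hz).mono fun y hy => ih y hy)
      have := e1.unique e3
      push_cast
      rw [← this]
      ring
  have h4 : ∀ k : ℕ, (∃ M : ℝ, ∀ z, 1 ≤ z → |iteratedDeriv k C z| ≤ M) ∧
      (∃ M : ℝ, ∀ z, 1 ≤ z → |iteratedDeriv (k + 1) C z| ≤ M) := by
    intro k
    induction k with
    | zero =>
      refine ⟨⟨1, fun z hz => ?_⟩, ⟨1, fun z hz => ?_⟩⟩
      · rw [iteratedDeriv_zero, ← Real.sq_sqrt (zero_le_one.trans hz), h]
        exact Real.abs_cos_le_one _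
      · have := h1 (Real.sqrt z)
        rw [Real.sq_sqrt (zero_le_one.trans hz)] at this
        have h5 : 1 ≤ Real.sqrt z := Real.one_le_sqrt.2 hz
        have h6 : |2 * √z * iteratedDeriv 1 C z| ≤ 1 := by
          rw [this, abs_neg]; exact Real.abs_sin_le_one _
        rw [abs_mul, abs_of_nonneg (by positivity)] at h6
        simp only [zero_add]
        nlinarith [abs_nonneg (iteratedDeriv 1 C z)]
    | succ k ih =>
      refine ⟨ih.2, ?_⟩
      obtain ⟨⟨M, hM⟩, ⟨M', hM'⟩⟩ := ih
      refine ⟨(4 * k + 2) * M' + M, fun z hz => ?_⟩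
      have e := h3 k z (by linarith)
      have e1 := hM z hz
      have e2 := hM' z hz
      have e3 : 4 * z * iteratedDeriv (k + 2) C z =
        - ((4 * k + 2) * iteratedDeriv (k + 1) C z + iteratedDeriv k C z) := by linarith
      have e4 : 4 * z * |iteratedDeriv (k + 2) C z| ≤ (4 * k + 2) * M' + M := by
        have : 4 * z * |iteratedDeriv (k + 2) C z| = |4 * z * iteratedDeriv (k + 2) C z| := by
          rw [abs_mul, abs_of_nonneg (by linarith : (0:ℝ) ≤ 4 * z)]
        rw [this, e3, abs_neg]
        refine (abs_add_le _ _).trans ?_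
        rw [abs_mul, abs_of_nonneg (by positivity : (0:ℝ) ≤ 4 * k + 2)]
        gcongr
      change |iteratedDeriv (k + 2) C z| ≤ _
      nlinarith [abs_nonneg (iteratedDeriv (k + 2) C z)]
  exact (h4 k).1

lemma exists_BD_cos : ∃ C : ℝ → ℂ, BD C ∧ ∀ w : ℝ, C (w ^ 2) = (Real.cos w : ℂ) := by
  obtain ⟨C, hC, h⟩ := exists_cosSqrt
  set C1 : ℝ → ℝ := fun z => Real.smoothTransition (z + 1) * C z with hC1
  have hs : ContDiff ℝ ∞ C1 :=
    (Real.smoothTransition.contDiff.comp (contDiff_id.add contDiff_const)).mul hC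
  have hb : ∀ n : ℕ, ∃ M : ℝ, ∀ x, ‖iteratedFDeriv ℝ n C1 x‖ ≤ M := by
    intro n
    obtain ⟨M, hM⟩ := cosSqrt_bound hC h n
    obtain ⟨M', hM'⟩ := (isCompact_Icc (a := (-2:ℝ)) (b := 1)).exists_bound_of_continuousOn
      (f := iteratedFDeriv ℝ n C1)
      ((hs.continuous_iteratedFDeriv (m := n) (by exact_mod_cast le_top)).continuousOn)
    refine ⟨max (max M M') 0, fun x => ?_⟩
    rcases lt_or_ge x (-2) with hx | hx
    · have : C1 =ᶠ[𝓝 x] fun _ => 0 := by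
        filter_upwards [gt_mem_nhds hx] with y hy
        simp only [hC1]
        rw [Real.smoothTransition.zero_of_nonpos (by linarith), zero_mul]
      rw [Filter.EventuallyEq.eq_of_nhds (Filter.EventuallyEq.iteratedFDeriv ℝ this n), norm_iteratedFDeriv_eq_norm_iteratedDeriv]
      simp
    · rcases le_or_gt x 1 with hx1 | hx1
      · exact (hM' x ⟨hx, hx1⟩).trans ((le_max_right _ _).trans (le_max_left _ _))
      · have : C1 =ᶠ[𝓝 x] C := by
          filter_upwards [lt_mem_nhds hx1] with y hy
          simp only [hC1]
          rw [Real.smoothTransition.one_of_one_le (by linarith), one_mul]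
        rw [Filter.EventuallyEq.eq_of_nhds (Filter.EventuallyEq.iteratedFDeriv ℝ this n), norm_iteratedFDeriv_eq_norm_iteratedDeriv]
        exact (hM x hx1.le).trans ((le_max_left _ _).trans (le_max_left _ _))
  refine ⟨fun z => (C1 z : ℂ), ⟨Complex.ofRealCLM.contDiff.comp hs, fun n => ?_⟩, fun w => ?_⟩
  · obtain ⟨M, hM⟩ := hb n
    refine ⟨M, fun x => ?_⟩
    have := Complex.ofRealLI.norm_iteratedFDeriv_comp_left (f := C1) (x := x) (n := ∞) (i := n)
      hs.contDiffAt (by exact_mod_cast le_top)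
    exact this.le.trans (hM x)
  · simp only [hC1]
    rw [h, Real.smoothTransition.one_of_one_le (by nlinarith [sq_nonneg w]), one_mul]

lemma BD_exp : BD (fun θ : ℝ => Complex.exp (Complex.I * θ)) := by
  have hs : ContDiff ℝ ∞ (fun θ : ℝ => Complex.exp (Complex.I * θ)) :=
    (contDiff_const.mul Complex.ofRealCLM.contDiff).cexp
  refine ⟨hs, fun n => ⟨1, fun x => ?_⟩⟩
  rw [norm_iteratedFDeriv_eq_norm_iteratedDeriv]
  have : ∀ n : ℕ, iteratedDeriv n (fun θ : ℝ => Complex.exp (Complex.I * θ)) =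
      fun θ : ℝ => Complex.I ^ n * Complex.exp (Complex.I * θ) := by
    intro n
    induction n with
    | zero => simp
    | succ n ih =>
      rw [iteratedDeriv_succ, ih]
      ext θ
      have h1 : HasDerivAt (fun θ : ℝ => Complex.I * (θ : ℂ)) (Complex.I * 1) θ :=
        (Complex.ofRealCLM.hasDerivAt).const_mul _
      rw [(h1.cexp.const_mul _).deriv]
      ring
  rw [this]
  simp only [norm_mul, norm_pow, Complex.norm_I, one_pow, one_mul]
  rw [mul_comm, Complex.norm_exp_ofReal_mul_I]

lemma exists_BD_sin {C : ℝ → ℂ} (hC : BD C) (h : ∀ w : ℝ, C (w ^ 2) = (Real.cos w : ℂ)) :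
    ∃ T : ℝ → ℂ, BD T ∧ ∀ w : ℝ, (Real.sin w : ℂ) = w + w ^ 3 * T (w ^ 2) := by
  set L : ℝ → ℝ →L[ℝ] ℝ := fun t => (t ^ 2) • ContinuousLinearMap.id ℝ ℝ with hL
  have hLc : Continuous L := by fun_prop
  set d : ℝ → ℂ := fun t => (((-(1 - t) ^ 2 / 2 : ℝ)) : ℂ) with hd
  have hdc : Continuous d := by fun_prop
  have := hC.integral (volume.restrict (Set.Ioc (0:ℝ) 1)) hdc hLc (fun n => by
    refine (Continuous.integrableOn_Icc ?_).mono_set Set.Ioc_subset_Icc_self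
    fun_prop)
  refine ⟨_, this, fun w => ?_⟩
  have e1 : ∀ t, d t * C (L t (w ^ 2)) = ((-(1 - t) ^ 2 / 2 * Real.cos (t * w) : ℝ) : ℂ) := by
    intro t
    have : L t (w ^ 2) = (t * w) ^ 2 := by simp [hL]; ring
    rw [this, h]; simp [hd]
  simp only [e1]
  rw [integral_complex_ofReal, ← intervalIntegral.integral_of_le zero_le_one]
  norm_cast
  have e2 : ∀ t ∈ Set.uIcc (0:ℝ) 1, HasDerivAt (fun t : ℝ => -(w ^ 2 * (1 - t) ^ 2 * Real.sin (t * w)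
      - 2 * w * (1 - t) * Real.cos (t * w) - 2 * Real.sin (t * w)) / 2)
      (w ^ 3 * (-(1 - t) ^ 2 / 2 * Real.cos (t * w))) t := by
    intro t _
    have a1 : HasDerivAt (fun t : ℝ => 1 - t) (-1) t := by simpa using (hasDerivAt_id t).const_sub 1
    have a2 : HasDerivAt (fun t : ℝ => t * w) w t := by simpa using (hasDerivAt_id t).mul_const w
    have := (((((a1.pow 2).const_mul (w ^ 2)).mul a2.sin).sub ((a1.const_mul (2 * w)).mul a2.cos)).sub
      (a2.sin.const_mul 2)).neg.div_const 2
    refine HasDerivAt.congr_deriv this ?_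
    simp
    ring
  have e3 := intervalIntegral.integral_eq_sub_of_hasDerivAt e2
    (Continuous.intervalIntegrable (by fun_prop) _ _)
  rw [intervalIntegral.integral_const_mul] at e3
  rw [e3]
  simp
end

section
open scoped FourierTransform SchwartzMap

lemma BD.integrable_comp {E V α : Type*} [NormedAddCommGroup E] [NormedSpace ℝ E]
    [NormedAddCommGroup V] [NormedSpace ℝ V]
    [TopologicalSpace α] [SecondCountableTopology α] [MeasurableSpace α]
    [BorelSpace α] (μ : Measure α) {Ψ : V → ℂ} (hΨ : BD Ψ)
    {d : α → ℂ} (hd : Continuous d) {L : α → E →L[ℝ] V} (hL : Continuous L)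
    (hdInt : Integrable (fun a => ‖d a‖) μ) (e : E) :
    Integrable (fun a => d a * Ψ (L a e)) μ := by
  obtain ⟨M, hM⟩ := hΨ.2 0
  refine (hdInt.mul_const M).mono' ?_ (Eventually.of_forall fun a => ?_)
  · exact (hd.mul (hΨ.1.continuous.comp (hL.clm_apply continuous_const))).aestronglyMeasurable
  · rw [norm_mul]
    gcongr
    simpa using hM (L a e)

/-- the Euclidean version of `ℝ³` -/
abbrev V3 := EuclideanSpace ℝ (Fin 3)

lemma schwartz_int (g : 𝓢(V3, ℂ)) (m : ℕ) : Integrable (fun ξ => (1 + ‖ξ‖) ^ m * ‖g ξ‖) := by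
  have h1 := (g.integrable_pow_mul volume 0).const_mul ((2:ℝ) ^ (m - 1))
  have h2 := (g.integrable_pow_mul volume m).const_mul ((2:ℝ) ^ (m - 1))
  refine (h1.add h2).mono' ?_ (Eventually.of_forall fun ξ => ?_)
  · exact Continuous.aestronglyMeasurable (by fun_prop)
  · rw [Real.norm_of_nonneg (by positivity)]
    have := add_pow_le (zero_le_one (α := ℝ)) (norm_nonneg ξ) m
    simp only [Pi.add_apply, pow_zero, one_mul, one_pow] at this ⊢
    calc _ ≤ (2 ^ (m - 1) * (1 + ‖ξ‖ ^ m)) * ‖g ξ‖ := by gcongr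
      _ = _ := by ring

/-- frequency map -/
noncomputable def freqL (ξ : V3) : ℝ × ℝ × ℝ →L[ℝ] ℝ × ℝ :=
  (2 * Real.pi * ξ 0) • (ContinuousLinearMap.fst ℝ ℝ (ℝ × ℝ)).prod 0 +
  (2 * Real.pi * ξ 1) • ((ContinuousLinearMap.fst ℝ ℝ ℝ).comp
    (ContinuousLinearMap.snd ℝ ℝ (ℝ × ℝ))).prod 0 +
  ((2 * Real.pi * ξ 2) ^ 2) • (0 : ℝ × ℝ × ℝ →L[ℝ] ℝ).prod ((ContinuousLinearMap.snd ℝ ℝ ℝ).comp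
    (ContinuousLinearMap.snd ℝ ℝ (ℝ × ℝ)))

lemma freqL_apply (ξ : V3) (e : ℝ × ℝ × ℝ) : freqL ξ e =
    (2 * Real.pi * (ξ 0 * e.1 + ξ 1 * e.2.1), (2 * Real.pi * ξ 2) ^ 2 * e.2.2) := by
  simp [freqL]; ring

lemma freqL_cont : Continuous freqL := by
  unfold freqL
  fun_prop

lemma freqL_bound : ∃ K : ℝ, 0 ≤ K ∧ ∀ ξ, ‖freqL ξ‖ ≤ K * (1 + ‖ξ‖) ^ 2 := by
  refine ⟨(2 * Real.pi) + (2 * Real.pi) ^ 2, by positivity, fun ξ => ?_⟩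
  refine ContinuousLinearMap.opNorm_le_bound _ (by positivity) fun e => ?_
  rw [freqL_apply, Prod.norm_def]
  have h0 : |ξ 0| ≤ ‖ξ‖ := by simpa using PiLp.norm_apply_le ξ 0
  have h1 : |ξ 1| ≤ ‖ξ‖ := by simpa using PiLp.norm_apply_le ξ 1
  have h2 : |ξ 2| ≤ ‖ξ‖ := by simpa using PiLp.norm_apply_le ξ 2
  have g0 : |e.1| ≤ ‖e‖ := norm_fst_le e
  have g1 : |e.2.1| ≤ ‖e‖ := (norm_fst_le e.2).trans (norm_snd_le e)
  have g2 : |e.2.2| ≤ ‖e‖ := (norm_snd_le e.2).trans (norm_snd_le e)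
  have hp := Real.pi_pos
  have a1 : ‖2 * Real.pi * (ξ 0 * e.1 + ξ 1 * e.2.1)‖ ≤ 2 * Real.pi * (‖ξ‖ * ‖e‖ + ‖ξ‖ * ‖e‖) := by
    rw [norm_mul, Real.norm_of_nonneg (by positivity : 0 ≤ 2 * Real.pi)]
    gcongr
    refine (abs_add_le _ _).trans ?_
    rw [abs_mul, abs_mul]
    gcongr
  have a2 : ‖(2 * Real.pi * ξ 2) ^ 2 * e.2.2‖ ≤ (2 * Real.pi * ‖ξ‖) ^ 2 * ‖e‖ := by
    rw [norm_mul, norm_pow, norm_mul, Real.norm_of_nonneg (by positivity : 0 ≤ 2 * Real.pi)]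
    simp only [Real.norm_eq_abs]
    gcongr
  have n1 := norm_nonneg ξ
  have n2 := norm_nonneg e
  refine max_le (a1.trans ?_) (a2.trans ?_)
  · have : 2 * Real.pi * (‖ξ‖ * ‖e‖ + ‖ξ‖ * ‖e‖) ≤ 2 * Real.pi * (1 + ‖ξ‖) ^ 2 * ‖e‖ := by
      have : (‖ξ‖ + ‖ξ‖) * ‖e‖ ≤ (1 + ‖ξ‖) ^ 2 * ‖e‖ := by gcongr; nlinarith
      nlinarith
    refine this.trans ?_
    gcongr
    nlinarith
  · have : (2 * Real.pi * ‖ξ‖) ^ 2 * ‖e‖ ≤ (2 * Real.pi) ^ 2 * (1 + ‖ξ‖) ^ 2 * ‖e‖ := by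
      rw [mul_pow]; gcongr; linarith
    refine this.trans ?_
    gcongr
    nlinarith

lemma weight_int (g : 𝓢(V3, ℂ)) (j : ℕ) (n : ℕ) :
    Integrable (fun ξ : V3 => ‖g ξ * (Complex.I * ((2 * Real.pi * ξ 2 : ℝ) : ℂ) ^ j)‖ * ‖freqL ξ‖ ^ n) := by
  obtain ⟨K, hK, hb⟩ := freqL_bound
  have := (schwartz_int g (j + 2 * n)).const_mul ((2 * Real.pi) ^ j * K ^ n)
  refine this.mono' ?_ (Eventually.of_forall fun ξ => ?_)
  · have := freqL_cont
    exact Continuous.aestronglyMeasurable (by fun_prop)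
  · have h2 : |ξ 2| ≤ 1 + ‖ξ‖ := by
      have : |ξ 2| ≤ ‖ξ‖ := by simpa using PiLp.norm_apply_le ξ 2
      linarith
    rw [Real.norm_of_nonneg (by positivity)]
    rw [norm_mul, norm_mul, Complex.norm_I, one_mul, norm_pow, Complex.norm_real, norm_mul,
      Real.norm_of_nonneg (by positivity : 0 ≤ 2 * Real.pi)]
    simp only [Real.norm_eq_abs]
    calc _ ≤ ‖g ξ‖ * (2 * Real.pi * (1 + ‖ξ‖)) ^ j * (K * (1 + ‖ξ‖) ^ 2) ^ n := by
            gcongr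
            exact hb ξ
      _ = _ := by
        generalize 1 + ‖ξ‖ = A
        simp only [mul_pow, ← pow_mul, pow_add]
        ring

theorem whitney_decomp (f : ℝ × ℝ × ℝ → ℝ) (hf : ContDiff ℝ ∞ f) (hs : HasCompactSupport f) :
    ∃ (E B : ℝ × ℝ × ℝ → ℝ) (N : ℝ → ℝ → ℝ), ContDiff ℝ ∞ E ∧ ContDiff ℝ ∞ B ∧
      ∀ u v w, f (u, v, w) = E (u, v, w ^ 2) + w * N u v + w ^ 3 * B (u, v, w ^ 2) := by
  obtain ⟨C, hC, hcos⟩ := exists_BD_cos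
  obtain ⟨T, hT, hsin⟩ := exists_BD_sin hC hcos
  let Q : V3 → ℝ × ℝ × ℝ := fun x => (x 0, x 1, x 2)
  have hQ : ContDiff ℝ ∞ Q := by fun_prop
  have hQe : Topology.IsClosedEmbedding Q := by
    have : Q = fun x => (((EuclideanSpace.equiv (Fin 3) ℝ) x) 0, ((EuclideanSpace.equiv (Fin 3) ℝ) x) 1,
      ((EuclideanSpace.equiv (Fin 3) ℝ) x) 2) := rfl
    refine Topology.IsClosedEmbedding.of_continuous_injective_isClosedMap hQ.continuous ?_ ?_
    · intro x y h
      simp only [Q, Prod.mk.injEq] at h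
      ext i; fin_cases i
      · exact h.1
      · exact h.2.1
      · exact h.2.2
    · let R : ℝ × ℝ × ℝ → V3 := fun p => !₂[p.1, p.2.1, p.2.2]
      have hR : Continuous R := by fun_prop
      have : ∀ S : Set V3, Q '' S = R ⁻¹' S := by
        intro S
        ext p
        constructor
        · rintro ⟨x, hx, rfl⟩
          have : R (Q x) = x := by ext i; fin_cases i <;> simp [R, Q]
          rw [Set.mem_preimage, this]; exact hx
        · intro h
          exact ⟨R p, h, by simp [R, Q]⟩
      intro S hS
      rw [this]
      exact hS.preimage hR
  have hcs : HasCompactSupport (fun x : V3 => ((f (Q x) : ℝ) : ℂ)) := by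
    have := hs.comp_isClosedEmbedding hQe
    exact this.comp_left (g := fun x : ℝ => (x : ℂ)) (by simp)
  have hsm : ContDiff ℝ ∞ (fun x : V3 => ((f (Q x) : ℝ) : ℂ)) :=
    Complex.ofRealCLM.contDiff.comp (hf.comp hQ)
  let F0 : 𝓢(V3, ℂ) := hcs.toSchwartzMap hsm
  have hF0 : ∀ x, F0 x = ((f (Q x) : ℝ) : ℂ) := fun x => rfl
  let g : 𝓢(V3, ℂ) := 𝓕 F0
  have hinv : ∀ x, F0 x = ∫ ξ, Complex.exp (((2 * Real.pi * inner ℝ ξ x : ℝ) : ℂ) * Complex.I) • g ξ := by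
    intro x
    rw [← Real.fourierInv_eq', ← SchwartzMap.fourierInv_coe]
    have h : (𝓕⁻ g : 𝓢(V3, ℂ)) = F0 :=
      FourierTransform.fourierInv_fourier_eq (E := 𝓢(V3, ℂ)) (F := 𝓢(V3, ℂ)) F0
    rw [h]
  have hex : BD (fun x : ℝ × ℝ => Complex.exp (Complex.I * x.1)) :=
    BD_exp.comp_clm (ContinuousLinearMap.fst ℝ ℝ ℝ)
  have hE : BD (fun x : ℝ × ℝ => Complex.exp (Complex.I * x.1) * C x.2) :=
    hex.mul (hC.comp_clm (ContinuousLinearMap.snd ℝ ℝ ℝ))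
  have hB : BD (fun x : ℝ × ℝ => Complex.exp (Complex.I * x.1) * T x.2) :=
    hex.mul (hT.comp_clm (ContinuousLinearMap.snd ℝ ℝ ℝ))
  let d : ℕ → V3 → ℂ := fun j ξ => g ξ * (Complex.I * ((2 * Real.pi * ξ 2 : ℝ) : ℂ) ^ j)
  have hdc : ∀ j, Continuous (d j) := fun j => by simp only [d]; fun_prop
  have hd0 : ∀ j, Integrable (fun ξ => ‖d j ξ‖) := fun j => by
    simpa only [pow_zero, mul_one] using weight_int g j 0
  have cE := (hE.integral volume (hdc 0) freqL_cont (weight_int g 0)).1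
  have cB := (hB.integral volume (hdc 3) freqL_cont (weight_int g 3)).1
  have iE := hE.integrable_comp volume (hdc 0) freqL_cont (hd0 0)
  have iN := hex.integrable_comp volume (hdc 1) freqL_cont (hd0 1)
  have iB := hB.integrable_comp volume (hdc 3) freqL_cont (hd0 3)
  refine ⟨fun e => ((-Complex.I) * _ : ℂ).re, fun e => (_ : ℂ).re,
    fun u v => (∫ ξ, d 1 ξ * Complex.exp (Complex.I * (freqL ξ (u, v, 0)).1)).re,
    Complex.reCLM.contDiff.comp (contDiff_const.mul cE), Complex.reCLM.contDiff.comp cB, fun u v w => ?_⟩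
  have key : ((f (u, v, w) : ℝ) : ℂ) =
      -Complex.I * (∫ ξ, d 0 ξ * (Complex.exp (Complex.I * (freqL ξ (u, v, w ^ 2)).1) *
        C (freqL ξ (u, v, w ^ 2)).2)) +
      w * (∫ ξ, d 1 ξ * Complex.exp (Complex.I * (freqL ξ (u, v, 0)).1)) +
      (w ^ 3 : ℝ) * (∫ ξ, d 3 ξ * (Complex.exp (Complex.I * (freqL ξ (u, v, w ^ 2)).1) *
        T (freqL ξ (u, v, w ^ 2)).2)) := by
    have := hinv !₂[u, v, w]
    rw [hF0] at this
    have hQx : Q !₂[u, v, w] = (u, v, w) := by simp [Q]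
    rw [hQx] at this
    have j1 := (iE (u, v, w ^ 2)).const_mul (-Complex.I)
    have j2 := (iN (u, v, 0)).const_mul (w : ℂ)
    have j3 := (iB (u, v, w ^ 2)).const_mul ((w ^ 3 : ℝ) : ℂ)
    rw [this, ← integral_const_mul, ← integral_const_mul, ← integral_const_mul]
    refine Eq.trans ?_ ((integral_add (j1.add j2) j3).trans
      (congrArg₂ (· + ·) (integral_add j1 j2) rfl))
    refine integral_congr_ae (Eventually.of_forall fun ξ => ?_)
    simp only [Pi.add_apply]
    have hin : (inner ℝ ξ !₂[u, v, w] : ℝ) = ξ 0 * u + ξ 1 * v + ξ 2 * w := by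
      simp [PiLp.inner_apply, Fin.sum_univ_three]; ring
    simp only [freqL_apply, d, hin, smul_eq_mul]
    set θ : ℝ := 2 * Real.pi * (ξ 0 * u + ξ 1 * v) with hθ
    set κ : ℝ := 2 * Real.pi * ξ 2 with hκ
    have e1 : 2 * Real.pi * (ξ 0 * u + ξ 1 * v + ξ 2 * w) = θ + κ * w := by
      rw [hθ, hκ]; ring
    rw [e1, ← mul_pow]
    have e2 : Complex.exp (((θ + κ * w : ℝ) : ℂ) * Complex.I) = Complex.exp (Complex.I * θ) *
        ((Real.cos (κ * w) : ℂ) + (Real.sin (κ * w) : ℂ) * Complex.I) := by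
      rw [Complex.ofReal_cos, Complex.ofReal_sin, ← Complex.exp_mul_I, ← Complex.exp_add]
      congr 1; push_cast; ring
    rw [e2, hsin, ← hcos]
    push_cast
    linear_combination (Complex.exp (Complex.I * θ) * g ξ * C ((κ * w) ^ 2)) * Complex.I_sq
  have := congrArg Complex.re key
  rw [Complex.ofReal_re, Complex.add_re, Complex.add_re, Complex.re_ofReal_mul, Complex.re_ofReal_mul] at this
  exact this
end

end

section
open scoped Topology ContDiff
open Filter Asymptotics

lemma littleO_sq_of_deriv {ζ ζ' : ℝ → E4} (h : ∀ᶠ τ in 𝓝 (0:ℝ), HasDerivAt ζ (ζ' τ) τ)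
    (ho : ζ' =o[𝓝 0] (fun τ : ℝ => τ)) :
    (fun τ => ζ τ - ζ 0) =o[𝓝 0] (fun τ : ℝ => τ ^ 2) := by
  rw [isLittleO_iff]
  intro ε hε
  obtain ⟨d, hd, hball⟩ := Metric.eventually_nhds_iff_ball.1 (h.and (isLittleO_iff.1 ho hε))
  refine Metric.eventually_nhds_iff_ball.2 ⟨d, hd, fun τ hτ => ?_⟩
  have hsub : Metric.closedBall (0:ℝ) |τ| ⊆ Metric.ball 0 d := by
    apply Metric.closedBall_subset_ball
    simpa using hτ
  have := (convex_closedBall (0:ℝ) |τ|).norm_image_sub_le_of_norm_hasDerivWithin_le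
    (f := ζ) (f' := ζ') (C := ε * |τ|) (x := 0) (y := τ)
    (fun x hx => (hball x (hsub hx)).1.hasDerivWithinAt)
    (fun x hx => by
      refine (hball x (hsub hx)).2.trans ?_
      gcongr
      simpa using hx) (by simp) (by simp)
  refine this.trans (le_of_eq ?_)
  simp only [sub_zero, norm_pow, Real.norm_eq_abs]
  ring

lemma locInv {E : Type*} [NormedAddCommGroup E] [NormedSpace ℝ E] [FiniteDimensional ℝ E]
    {f : E → E} (hf : ContDiff ℝ ∞ f) (p : E) (hinj : Function.Injective (fderiv ℝ f p)) :
    ∃ g : E → E, g (f p) = p ∧ (∀ᶠ y in 𝓝 (f p), ContDiffAt ℝ ∞ g y) ∧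
      (∀ᶠ x in 𝓝 p, g (f x) = x) ∧ (∀ᶠ y in 𝓝 (f p), f (g y) = y) ∧
      Function.Bijective (fderiv ℝ g (f p)) := by
  have : CompleteSpace E := FiniteDimensional.complete ℝ E
  have hne : (∞ : WithTop ℕ∞) ≠ 0 := by simp
  let e : E ≃L[ℝ] E :=
    (LinearEquiv.ofInjectiveEndo (fderiv ℝ f p : E →ₗ[ℝ] E) hinj).toContinuousLinearEquiv
  have he : (e : E →L[ℝ] E) = fderiv ℝ f p := by
    ext x; rfl
  have hfd : HasFDerivAt f (e : E →L[ℝ] E) p := by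
    rw [he]; exact (hf.differentiable hne p).hasFDerivAt
  let P := hf.contDiffAt.toOpenPartialHomeomorph f hfd hne
  have hPc : (P : E → E) = f := rfl
  have hps : p ∈ P.source := hf.contDiffAt.mem_toOpenPartialHomeomorph_source hfd hne
  have hpt : f p ∈ P.target := P.map_source hps
  have hgp : P.symm (f p) = p := P.left_inv hps
  have hL : ∀ᶠ x in 𝓝 p, P.symm (f x) = x :=
    eventually_of_mem (P.open_source.mem_nhds hps) fun x hx => P.left_inv hx
  have hR : ∀ᶠ y in 𝓝 (f p), f (P.symm y) = y :=
    eventually_of_mem (P.open_target.mem_nhds hpt) fun x hx => P.right_inv hx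
  have hcs : ContinuousAt P.symm (f p) := P.continuousAt_symm hpt
  have hsm : ∀ᶠ y in 𝓝 (f p), ContDiffAt ℝ ∞ P.symm y := by
    have hc : ContinuousAt (fun y => fderiv ℝ f (P.symm y)) (f p) :=
      (hf.continuous_fderiv hne).continuousAt.comp hcs
    have hrange := ContinuousLinearEquiv.nhds e
    rw [he, ← hgp] at hrange
    filter_upwards [hc hrange, P.open_target.mem_nhds hpt] with y hy hyt
    obtain ⟨e', he'⟩ := hy
    refine P.contDiffAt_symm (f₀' := e') hyt ?_ hf.contDiffAt
    rw [he']
    exact (hf.differentiable hne _).hasFDerivAt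
  refine ⟨P.symm, hgp, hsm, hL, hR, ?_⟩
  have hgd : HasFDerivAt P.symm (fderiv ℝ P.symm (f p)) (f p) :=
    (hsm.self_of_nhds.differentiableAt hne).hasFDerivAt
  have h1 := hgd.comp p hfd
  have h2 : HasFDerivAt (P.symm ∘ f) (ContinuousLinearMap.id ℝ E) p :=
    (hasFDerivAt_id p).congr_of_eventuallyEq hL
  have h3 := h1.unique h2
  have h4 : ∀ x, fderiv ℝ P.symm (f p) (e x) = x := fun x => by
    simpa using DFunLike.congr_fun h3 x
  have h5 : (fderiv ℝ P.symm (f p) : E → E) = e.symm := by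
    ext x
    simpa using h4 (e.symm x)
  rw [h5]
  exact e.symm.bijective

lemma evenOdd_deriv {e β : ℝ → E4} (he : ContDiff ℝ ∞ e) (hβ : ContDiff ℝ ∞ β) {m : ℝ → E4} {m' : E4}
    (h : ∀ᶠ w in 𝓝 (0:ℝ), HasDerivAt (fun w : ℝ => e (w ^ 2) + w ^ 3 • β (w ^ 2)) (w • m w) w)
    (hm : HasDerivAt m m' 0) : m 0 = (2:ℝ) • deriv e 0 ∧ m' = (3:ℝ) • β 0 := by
  have hne : (∞ : WithTop ℕ∞) ≠ 0 := by simp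
  have h2 : ∀ w : ℝ, HasDerivAt (fun w : ℝ => w ^ 2) (2 * w) w := fun w => by
    simpa using hasDerivAt_pow 2 w
  have h3 : ∀ w : ℝ, HasDerivAt (fun w : ℝ => w ^ 3) (3 * w ^ 2) w := fun w => by
    simpa using hasDerivAt_pow 3 w
  have hd : ∀ {f : ℝ → E4}, ContDiff ℝ ∞ f → ∀ w : ℝ,
      HasDerivAt (fun w : ℝ => f (w ^ 2)) ((2 * w) • deriv f (w ^ 2)) w := fun {f} hf w =>
    HasDerivAt.scomp (h := fun w : ℝ => w ^ 2) w (hf.differentiable hne _).hasDerivAt (h2 w)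
  have he' : ContDiff ℝ ∞ (deriv e) := by
    have : ContDiff ℝ (∞ + 1) e := by simpa using he
    exact (contDiff_succ_iff_deriv.1 this).2.2
  have hβ' : ContDiff ℝ ∞ (deriv β) := by
    have : ContDiff ℝ (∞ + 1) β := by simpa using hβ
    exact (contDiff_succ_iff_deriv.1 this).2.2
  let R : ℝ → E4 := fun w => (2:ℝ) • deriv e (w ^ 2) + (3 * w) • β (w ^ 2)
    + (2 * w ^ 3) • deriv β (w ^ 2)
  have hR0 : HasDerivAt R ((3:ℝ) • β 0) 0 := by
    have a1 := (hd he' 0).const_smul (2:ℝ)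
    have a2 := ((hasDerivAt_id (0:ℝ)).const_mul 3).smul (hd hβ 0)
    have a3 := ((h3 0).const_mul 2).smul (hd hβ' 0)
    refine ((a1.add a2).add a3).congr_deriv ?_
    simp
  have hEq : ∀ᶠ w in 𝓝[≠] (0:ℝ), m w = R w := by
    filter_upwards [h.filter_mono nhdsWithin_le_nhds, self_mem_nhdsWithin] with w hw hw0
    have hw0 : w ≠ 0 := hw0
    have b := ((hd he w).add ((h3 w).smul (hd hβ w))).unique hw
    have : w • m w = w • R w := by
      rw [← b]
      simp only [R, smul_add, smul_smul]
      module
    exact smul_right_injective _ hw0 this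
  have h0 : m 0 = R 0 := by
    have t1 : Tendsto m (𝓝[≠] 0) (𝓝 (m 0)) := hm.continuousAt.tendsto.mono_left nhdsWithin_le_nhds
    have t2 : Tendsto R (𝓝[≠] 0) (𝓝 (R 0)) := hR0.continuousAt.tendsto.mono_left nhdsWithin_le_nhds
    exact tendsto_nhds_unique (t1.congr' hEq) t2
  have hEq' : m =ᶠ[𝓝 0] R := by
    rw [eventually_nhdsWithin_iff] at hEq
    filter_upwards [hEq] with w hw
    by_cases hw0 : w = 0
    · rw [hw0, h0]
    · exact hw hw0
  refine ⟨by simpa [R] using h0, hm.unique (hR0.congr_of_eventuallyEq hEq')⟩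

lemma decomp_local {K : ℝ × ℝ × ℝ → E4} (hK : ∀ᶠ x in 𝓝 (0 : ℝ × ℝ × ℝ), ContDiffAt ℝ ∞ K x)
    (hw : ∀ᶠ x in 𝓝 (0 : ℝ × ℝ × ℝ), x.2.2 = 0 →
      HasDerivAt (fun w => K (x.1, x.2.1, w)) 0 0) :
    ∃ E B : ℝ × ℝ × ℝ → E4, ContDiff ℝ ∞ E ∧ ContDiff ℝ ∞ B ∧
      ∀ᶠ x in 𝓝 (0 : ℝ × ℝ × ℝ), K x = E (x.1, x.2.1, x.2.2 ^ 2) +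
        x.2.2 ^ 3 • B (x.1, x.2.1, x.2.2 ^ 2) := by
  have hne : (∞ : WithTop ℕ∞) ≠ 0 := by simp
  obtain ⟨ε, hε, hball⟩ := Metric.eventually_nhds_iff_ball.1 hK
  let χ : ContDiffBump (0 : ℝ × ℝ × ℝ) := ⟨ε / 4, ε / 2, by positivity, by linarith⟩
  have hfs : ∀ i, ContDiff ℝ ∞ (fun x => χ x * K x i) := by
    intro i
    rw [contDiff_iff_contDiffAt]
    intro x
    by_cases hx : x ∈ Metric.ball (0 : ℝ × ℝ × ℝ) ε
    · exact χ.contDiffAt.mul ((contDiffAt_pi.1 (hball x hx)) i)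
    · have : x ∉ tsupport χ := by
        rw [χ.tsupport_eq]
        intro h
        apply hx
        exact Metric.closedBall_subset_ball (by change ε / 2 < ε; linarith) h
      have h0 : (fun x => χ x * K x i) =ᶠ[𝓝 x] fun _ => 0 := by
        filter_upwards [notMem_tsupport_iff_eventuallyEq.1 this] with y hy
        rw [hy]; simp
      exact contDiffAt_const.congr_of_eventuallyEq h0
  have hcs : ∀ i, HasCompactSupport (fun x => χ x * K x i) := fun i =>
    χ.hasCompactSupport.mul_right
  choose E B N hE hB hEB using fun i => whitney_decomp _ (hfs i) (hcs i)
  refine ⟨fun x i => E i x, fun x i => B i x, contDiff_pi.2 hE, contDiff_pi.2 hB, ?_⟩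
  have h1 : ∀ᶠ x in 𝓝 (0 : ℝ × ℝ × ℝ), χ x = 1 := χ.eventuallyEq_one
  have hN : ∀ᶠ x in 𝓝 (0 : ℝ × ℝ × ℝ), x.2.2 = 0 → ∀ i, N i x.1 x.2.1 = 0 := by
    filter_upwards [h1.eventually_nhds, hw] with x hx hwx h0 i
    have d1 := hasDerivAt_pi.1 (hwx h0) i
    have hx0 : (x.1, x.2.1, (0:ℝ)) = x := by rw [← h0]
    have hcont : Tendsto (fun w : ℝ => (x.1, x.2.1, w)) (𝓝 0) (𝓝 x) := by
      have : Continuous (fun w : ℝ => (x.1, x.2.1, w)) := by fun_prop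
      have := this.tendsto 0
      rwa [hx0] at this
    have hev : (fun w => E i (x.1, x.2.1, w ^ 2) + w * N i x.1 x.2.1 +
        w ^ 3 * B i (x.1, x.2.1, w ^ 2)) =ᶠ[𝓝 0] fun w => K (x.1, x.2.1, w) i := by
      filter_upwards [hcont.eventually hx] with w hw
      rw [← hEB i, hw, one_mul]
    have d2 := d1.congr_of_eventuallyEq hev
    have h2 : HasDerivAt (fun w : ℝ => w ^ 2) 0 0 := by
      simpa using hasDerivAt_pow 2 (0:ℝ)
    have h3 : HasDerivAt (fun w : ℝ => w ^ 3) 0 0 := by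
      simpa using hasDerivAt_pow 3 (0:ℝ)
    have hd : ∀ {f : ℝ × ℝ × ℝ → ℝ}, ContDiff ℝ ∞ f →
        HasDerivAt (fun w : ℝ => f (x.1, x.2.1, w ^ 2)) 0 0 := fun {f} hf => by
      have hf1 : ContDiff ℝ ∞ (fun y : ℝ => f (x.1, x.2.1, y)) :=
        hf.comp (by fun_prop)
      have := HasDerivAt.comp (h := fun w : ℝ => w ^ 2) (0:ℝ)
        (hf1.differentiable hne _).hasDerivAt h2
      rw [mul_zero] at this
      exact this
    have d3 := ((hd (hE i)).add ((hasDerivAt_id (0:ℝ)).mul_const (N i x.1 x.2.1))).add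
      (h3.mul (hd (hB i)))
    have := d3.unique d2
    simpa using this
  have hproj : Tendsto (fun x : ℝ × ℝ × ℝ => (x.1, x.2.1, (0:ℝ))) (𝓝 0) (𝓝 0) := by
    have : Continuous (fun x : ℝ × ℝ × ℝ => (x.1, x.2.1, (0:ℝ))) := by fun_prop
    exact this.tendsto 0
  filter_upwards [h1, hproj.eventually hN] with x hx hNx
  ext i
  have := hEB i x.1 x.2.1 x.2.2
  rw [hNx rfl i, mul_zero, add_zero] at this
  simp only [Prod.mk.eta, hx, one_mul] at this
  simpa using this

end

section
open scoped Topology ContDiff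
open Filter Asymptotics

lemma normal_form {K : ℝ × ℝ × ℝ → E4} (hK : ∀ᶠ x in 𝓝 (0 : ℝ × ℝ × ℝ), ContDiffAt ℝ ∞ K x)
    (hw : ∀ᶠ x in 𝓝 (0 : ℝ × ℝ × ℝ), x.2.2 = 0 →
      HasDerivAt (fun w => K (x.1, x.2.1, w)) 0 0)
    {x y : E4} {m : ℝ → E4} {m' : E4}
    (hx : HasDerivAt (fun u => K (u, 0, 0)) x 0)
    (hy : HasDerivAt (fun v => K (0, v, 0)) y 0)
    (hm : ∀ᶠ w in 𝓝 (0:ℝ), HasDerivAt (fun w => K (0, 0, w)) (w • m w) w)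
    (hm' : HasDerivAt m m' 0)
    (hli : ∀ c0 c1 c2 c3 : ℝ, c0 • x + c1 • y + c2 • m 0 + c3 • m' = 0 →
      c0 = 0 ∧ c1 = 0 ∧ c2 = 0 ∧ c3 = 0) :
    ∃ Φ : E4 → E4, IsDiffeoGermAt Φ (K 0) ∧ Φ (K 0) = 0 ∧
      ∀ᶠ x in 𝓝 (0 : ℝ × ℝ × ℝ), Φ (K x) = ![x.1, x.2.1, x.2.2 ^ 2, x.2.2 ^ 3] := by
  have hne : (∞ : WithTop ℕ∞) ≠ 0 := by simp
  obtain ⟨E, B, hE, hB, hEB⟩ := decomp_local hK hw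
  let π : E4 →L[ℝ] ℝ × ℝ × ℝ := (ContinuousLinearMap.proj 0).prod
    ((ContinuousLinearMap.proj 1).prod (ContinuousLinearMap.proj 2))
  have hπ : ∀ z : E4, π z = (z 0, z 1, z 2) := fun z => rfl
  let H : E4 → E4 := fun z => E (π z) + z 3 • B (π z)
  have hH : ContDiff ℝ ∞ H := by
    have h3 : ContDiff ℝ ∞ (fun z : E4 => z 3) := contDiff_apply ℝ ℝ 3
    exact (hE.comp π.contDiff).add (h3.smul (hB.comp π.contDiff))
  have hK0 : H 0 = K 0 := by
    have := hEB.self_of_nhds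
    rw [this]
    simp [H, hπ]
  have dE : HasFDerivAt E (fderiv ℝ E 0) 0 := (hE.differentiable hne 0).hasFDerivAt
  have dB : HasFDerivAt B (fderiv ℝ B 0) 0 := (hB.differentiable hne 0).hasFDerivAt
  have hπ0 : π 0 = 0 := map_zero π
  have dH : ∀ h : E4, fderiv ℝ H 0 h = fderiv ℝ E 0 (h 0, h 1, h 2) + h 3 • B 0 := by
    intro h
    rw [← hπ0] at dE dB
    have t1 := dE.comp (0 : E4) π.hasFDerivAt
    have t2 := dB.comp (0 : E4) π.hasFDerivAt
    have t3 : HasFDerivAt (fun z : E4 => z 3) (ContinuousLinearMap.proj (R := ℝ) (φ := fun _ : Fin 4 => ℝ) 3) 0 :=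
      (ContinuousLinearMap.proj (R := ℝ) (φ := fun _ : Fin 4 => ℝ) 3).hasFDerivAt
    have t4 := t1.add (t3.smul t2)
    have t5 : HasFDerivAt H _ 0 := t4
    rw [t5.fderiv]
    simp [hπ]
    rfl
  have line : ∀ l : ℝ → ℝ × ℝ × ℝ, ∀ l', l 0 = 0 → HasDerivAt l l' 0 →
      HasDerivAt (fun t => E (l t)) (fderiv ℝ E 0 l') 0 := by
    intro l l' h0 hl
    rw [← h0] at dE ⊢
    exact dE.comp_hasDerivAt 0 hl
  have evl : ∀ l : ℝ → ℝ × ℝ × ℝ, Continuous l → l 0 = 0 → ∀ {p : ℝ × ℝ × ℝ → Prop},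
      (∀ᶠ x in 𝓝 0, p x) → ∀ᶠ t in 𝓝 (0:ℝ), p (l t) := by
    intro l hl h0 p hp
    have := hl.tendsto 0
    rw [h0] at this
    exact this.eventually hp
  have e1 : fderiv ℝ E 0 (1, 0, 0) = x := by
    have l1 := line (fun t => (t, 0, 0)) (1, 0, 0) rfl
      ((hasDerivAt_id 0).prodMk ((hasDerivAt_const _ _).prodMk (hasDerivAt_const _ _)))
    refine l1.unique (hx.congr_of_eventuallyEq ?_)
    filter_upwards [evl (fun t => (t, 0, 0)) (by fun_prop) rfl hEB] with t ht
    rw [ht]; simp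
  have e2 : fderiv ℝ E 0 (0, 1, 0) = y := by
    have l1 := line (fun t => (0, t, 0)) (0, 1, 0) rfl
      ((hasDerivAt_const _ _).prodMk ((hasDerivAt_id 0).prodMk (hasDerivAt_const _ _)))
    refine l1.unique (hy.congr_of_eventuallyEq ?_)
    filter_upwards [evl (fun t => (0, t, 0)) (by fun_prop) rfl hEB] with t ht
    rw [ht]; simp
  have l3 := line (fun t => (0, 0, t)) (0, 0, 1) rfl
      ((hasDerivAt_const _ _).prodMk ((hasDerivAt_const _ _).prodMk (hasDerivAt_id 0)))
  have hq := evenOdd_deriv (e := fun t => E (0, 0, t)) (β := fun t => B (0, 0, t))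
    (hE.comp (by fun_prop)) (hB.comp (by fun_prop)) (m := m) (m' := m') (by
      have hev := evl (fun t => (0, 0, t)) (by fun_prop) rfl hEB
      filter_upwards [hm, hev.eventually_nhds] with w hw1 hw2
      refine hw1.congr_of_eventuallyEq ?_
      filter_upwards [hw2] with t ht
      rw [ht]) hm'
  rw [l3.deriv] at hq
  have hinj : Function.Injective (fderiv ℝ H 0) := by
    rw [injective_iff_map_eq_zero]
    intro h hh
    rw [dH] at hh
    have hs : ((h 0, h 1, h 2) : ℝ × ℝ × ℝ) = h 0 • (1, 0, 0) + h 1 • (0, 1, 0) + h 2 • (0, 0, 1) := by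
      simp
    rw [hs, map_add, map_add, map_smul, map_smul, map_smul, e1, e2] at hh
    have := hli (h 0) (h 1) (h 2 / 2) (h 3 / 3) (by
      rw [hq.1, hq.2, smul_smul, smul_smul, div_mul_cancel₀ _ (by norm_num),
        div_mul_cancel₀ _ (by norm_num)]
      exact hh)
    obtain ⟨q0, q1, q2, q3⟩ := this
    ext i
    fin_cases i
    · exact q0
    · exact q1
    · change h 2 = 0; linarith
    · change h 3 = 0; linarith
  obtain ⟨Φ, hΦ0, hΦs, hΦl, -, hΦb⟩ := locInv hH 0 hinj
  rw [hK0] at hΦ0 hΦs hΦb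
  refine ⟨Φ, ⟨hΦs.self_of_nhds, hΦb⟩, hΦ0, ?_⟩
  have hc : Tendsto (fun x : ℝ × ℝ × ℝ => (![x.1, x.2.1, x.2.2 ^ 2, x.2.2 ^ 3] : E4)) (𝓝 0) (𝓝 0) := by
    have : Continuous (fun x : ℝ × ℝ × ℝ => (![x.1, x.2.1, x.2.2 ^ 2, x.2.2 ^ 3] : E4)) := by
      refine continuous_pi fun i => ?_
      fin_cases i <;> simp <;> fun_prop
    have h := this.tendsto 0
    have h0 : (![(0 : ℝ × ℝ × ℝ).1, (0 : ℝ × ℝ × ℝ).2.1, (0 : ℝ × ℝ × ℝ).2.2 ^ 2,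
      (0 : ℝ × ℝ × ℝ).2.2 ^ 3] : E4) = 0 := by
      ext i; fin_cases i <;> simp
    rwa [h0] at h
  filter_upwards [hEB, hc.eventually hΦl] with x h1 h2
  rw [h1]
  exact h2

end

section
open scoped Topology ContDiff
open Filter Asymptotics

lemma exists_prim {b : ℝ → ℝ} (hb : ContDiff ℝ ∞ b) :
    ∃ P : ℝ → ℝ, ContDiff ℝ ∞ P ∧ P 0 = 0 ∧ ∀ t, HasDerivAt P (b t) t := by
  have hd : ∀ t, HasDerivAt (fun t => ∫ x in (0:ℝ)..t, b x) (b t) t := fun t =>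
    intervalIntegral.integral_hasDerivAt_right (hb.continuous.intervalIntegrable _ _)
      hb.continuous.aestronglyMeasurable.stronglyMeasurableAtFilter hb.continuous.continuousAt
  refine ⟨_, ?_, by simp, hd⟩
  have : ContDiff ℝ (∞ + 1) (fun t => ∫ x in (0:ℝ)..t, b x) := by
    rw [contDiff_succ_iff_deriv]
    refine ⟨fun t => (hd t).differentiableAt, by simp, ?_⟩
    have : deriv (fun t => ∫ x in (0:ℝ)..t, b x) = b := funext fun t => (hd t).deriv
    rw [this]; exact hb
  simpa using this

variable {γ X Y : ℝ → E4} {a b₁ b₂ b₃ : ℝ → ℝ}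

lemma only_if_part
    (hγ : ContDiff ℝ ∞ γ) (hX : ContDiff ℝ ∞ X) (hY : ContDiff ℝ ∞ Y)
    (ha : ContDiff ℝ ∞ a) (hb₁ : ContDiff ℝ ∞ b₁) (hb₂ : ContDiff ℝ ∞ b₂)
    (hb₃ : ContDiff ℝ ∞ b₃)
    (hY' : ∀ᶠ t in 𝓝 (0:ℝ), deriv Y t = a t • deriv X t)
    (hγ' : ∀ᶠ t in 𝓝 (0:ℝ), deriv γ t =
      b₁ t • X t + b₂ t • Y t + b₃ t • deriv X t)
    (s r : ℝ) (hsing : b₃ 0 + s + r * a 0 = 0)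
    (hA : AEquivAt (fun p => γ p.1 + p.2.1 • X p.1 + p.2.2 • Y p.1) (0, s, r)
      (fun q => ![q.1, q.2.1, q.2.2^2, q.2.2^3])) :
    r * deriv a 0 - a 0 * b₂ 0 - b₁ 0 + deriv b₃ 0 ≠ 0 := by
  intro hc
  have hne : (∞ : WithTop ℕ∞) ≠ 0 := by simp
  obtain ⟨P1, hP1, hP10, dP1⟩ := exists_prim hb₁
  obtain ⟨P2, hP2, hP20, dP2⟩ := exists_prim hb₂
  obtain ⟨φ, Φ, hφ, hΦ, hφ0, hΦ0, hev⟩ := hA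
  let α : ℝ → ℝ × ℝ × ℝ := fun τ => (τ, s - P1 τ, r - P2 τ)
  have hα0 : α 0 = (0, s, r) := by simp [α, hP10, hP20]
  have dα : HasDerivAt α (1, -b₁ 0, -b₂ 0) 0 :=
    (hasDerivAt_id 0).prodMk (((dP1 0).const_sub s).prodMk ((dP2 0).const_sub r))
  let ζ : ℝ → E4 := fun τ => γ τ + (s - P1 τ) • X τ + (r - P2 τ) • Y τ
  let ℓ : ℝ → ℝ := fun τ => b₃ τ + (s - P1 τ) + (r - P2 τ) * a τ
  have dζ : ∀ᶠ τ in 𝓝 (0:ℝ), HasDerivAt ζ (ℓ τ • deriv X τ) τ := by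
    filter_upwards [hY', hγ'] with τ h1 h2
    have t1 := (hγ.differentiable hne τ).hasDerivAt
    have t2 := ((dP1 τ).const_sub s).smul (hX.differentiable hne τ).hasDerivAt
    have t3 := ((dP2 τ).const_sub r).smul (hY.differentiable hne τ).hasDerivAt
    refine ((t1.add t2).add t3).congr_deriv ?_
    rw [h1, h2]
    simp only [ℓ]
    module
  have dℓ : HasDerivAt ℓ 0 0 := by
    have t := ((hb₃.differentiable hne 0).hasDerivAt.add ((dP1 0).const_sub s)).add
      (((dP2 0).const_sub r).mul (ha.differentiable hne 0).hasDerivAt)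
    refine t.congr_deriv ?_
    rw [hP20]; linear_combination hc
  have hℓ0 : ℓ 0 = 0 := by simp only [ℓ, hP10, hP20]; linear_combination hsing
  have oℓ : ℓ =o[𝓝 0] (fun τ : ℝ => τ) := by
    have := hasDerivAt_iff_isLittleO.1 dℓ
    simpa [hℓ0] using this
  have hX' : Continuous (deriv X) := hX.continuous_deriv (by simp)
  have oζ' : (fun τ => ℓ τ • deriv X τ) =o[𝓝 0] (fun τ : ℝ => τ) := by
    have : deriv X =O[𝓝 0] (fun _ => (1:ℝ)) := hX'.continuousAt.tendsto.isBigO_one ℝ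
    have := oℓ.smul_isBigO this
    simpa using this
  have oζ := littleO_sq_of_deriv dζ oζ'
  have hζ0 : ζ 0 = (fun p : ℝ × ℝ × ℝ => γ p.1 + p.2.1 • X p.1 + p.2.2 • Y p.1) (0, s, r) := by
    simp [ζ, hP10, hP20]
  rw [← hζ0] at hΦ hΦ0
  have cζ : Tendsto ζ (𝓝 0) (𝓝 (ζ 0)) := dζ.self_of_nhds.continuousAt
  have oΦ : (fun τ => Φ (ζ τ) - Φ (ζ 0)) =o[𝓝 0] (fun τ : ℝ => τ ^ 2) :=
    ((hΦ.1.differentiableAt hne).isBigO_sub.comp_tendsto cζ).trans_isLittleO oζ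
  have cα : Tendsto α (𝓝 0) (𝓝 (0, s, r)) := by
    rw [← hα0]; exact dα.continuousAt
  have heq : (fun τ => Φ (ζ τ) - Φ (ζ 0)) =ᶠ[𝓝 0] fun τ =>
      ![(φ (α τ)).1, (φ (α τ)).2.1, (φ (α τ)).2.2 ^ 2, (φ (α τ)).2.2 ^ 3] := by
    filter_upwards [cα.eventually hev] with τ hτ
    have : Φ (ζ τ) = _ := hτ
    rw [this, hΦ0]
    ext i; fin_cases i <;> simp
  have oβ := oΦ.congr' heq EventuallyEq.rfl
  rw [isLittleO_pi] at oβ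
  have osq : (fun τ : ℝ => τ ^ 2) =O[𝓝 0] (fun τ : ℝ => τ) := by
    have : (fun τ : ℝ => τ ^ 2) =o[𝓝 0] (fun τ : ℝ => τ) := by
      simpa using isLittleO_pow_pow (𝕜 := ℝ) (show 1 < 2 by norm_num)
    exact this.isBigO
  have o1 : (fun τ => (φ (α τ)).1) =o[𝓝 0] (fun τ : ℝ => τ) := (oβ 0).trans_isBigO osq
  have o2 : (fun τ => (φ (α τ)).2.1) =o[𝓝 0] (fun τ : ℝ => τ) := (oβ 1).trans_isBigO osq
  have o3 : (fun τ => (φ (α τ)).2.2) =o[𝓝 0] (fun τ : ℝ => τ) :=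
    IsLittleO.of_pow (n := 2) (oβ 2) (by norm_num)
  have oall : (fun τ => φ (α τ)) =o[𝓝 0] (fun τ : ℝ => τ) := o1.prod_left (o2.prod_left o3)
  have d0 : HasDerivAt (fun τ => φ (α τ)) 0 0 := by
    rw [hasDerivAt_iff_isLittleO]
    simpa [hα0, hφ0] using oall
  have dφ : HasFDerivAt φ (fderiv ℝ φ (0, s, r)) (α 0) := by
    rw [hα0]; exact (hφ.1.differentiableAt hne).hasFDerivAt
  have d1 := dφ.comp_hasDerivAt 0 dα
  have h0 := d1.unique d0
  have := hφ.2.1 (h0.trans (map_zero _).symm)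
  have := congrArg Prod.fst this
  simp at this

lemma if_part
    (hγ : ContDiff ℝ ∞ γ) (hX : ContDiff ℝ ∞ X) (hY : ContDiff ℝ ∞ Y)
    (ha : ContDiff ℝ ∞ a) (hb₁ : ContDiff ℝ ∞ b₁) (hb₂ : ContDiff ℝ ∞ b₂)
    (hb₃ : ContDiff ℝ ∞ b₃)
    (hY' : ∀ᶠ t in 𝓝 (0:ℝ), deriv Y t = a t • deriv X t)
    (hγ' : ∀ᶠ t in 𝓝 (0:ℝ), deriv γ t =
      b₁ t • X t + b₂ t • Y t + b₃ t • deriv X t)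
    (s r : ℝ) (hsing : b₃ 0 + s + r * a 0 = 0)
    (hdet : det4 (X 0) (Y 0) (deriv X 0) (deriv (deriv X) 0) ≠ 0)
    (hc : r * deriv a 0 - a 0 * b₂ 0 - b₁ 0 + deriv b₃ 0 ≠ 0) :
    AEquivAt (fun p => γ p.1 + p.2.1 • X p.1 + p.2.2 • Y p.1) (0, s, r)
      (fun q => ![q.1, q.2.1, q.2.2^2, q.2.2^3]) := by
  have hne : (∞ : WithTop ℕ∞) ≠ 0 := by simp
  obtain ⟨P1, hP1, hP10, dP1⟩ := exists_prim hb₁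
  obtain ⟨P2, hP2, hP20, dP2⟩ := exists_prim hb₂
  have hX1 : ContDiff ℝ ∞ (deriv X) := by
    have : ContDiff ℝ (∞ + 1) X := by simpa using hX
    exact (contDiff_succ_iff_deriv.1 this).2.2
  let φ : ℝ × ℝ × ℝ → ℝ × ℝ × ℝ := fun q =>
    (q.2.1 - s + P1 q.1, q.2.2 - r + P2 q.1, b₃ q.1 + q.2.1 + q.2.2 * a q.1)
  have hφ : ContDiff ℝ ∞ φ := by
    refine ContDiff.prodMk ?_ (ContDiff.prodMk ?_ ?_) <;> fun_prop
  have hφp : φ (0, s, r) = 0 := by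
    simp only [φ, hP10, hP20, hsing]; simp
  have dfst : ∀ q : ℝ × ℝ × ℝ, HasFDerivAt (fun q : ℝ × ℝ × ℝ => q.1)
    (ContinuousLinearMap.fst ℝ ℝ (ℝ × ℝ)) q := fun q => hasFDerivAt_fst
  have dsnd1 : ∀ q : ℝ × ℝ × ℝ, HasFDerivAt (fun q : ℝ × ℝ × ℝ => q.2.1)
    ((ContinuousLinearMap.fst ℝ ℝ ℝ).comp (ContinuousLinearMap.snd ℝ ℝ (ℝ × ℝ))) q := fun q =>
      hasFDerivAt_snd.fst
  have dsnd2 : ∀ q : ℝ × ℝ × ℝ, HasFDerivAt (fun q : ℝ × ℝ × ℝ => q.2.2)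
    ((ContinuousLinearMap.snd ℝ ℝ ℝ).comp (ContinuousLinearMap.snd ℝ ℝ (ℝ × ℝ))) q := fun q =>
      hasFDerivAt_snd.snd
  have dφ : ∀ q h, fderiv ℝ φ q h = (h.2.1 + b₁ q.1 * h.1, h.2.2 + b₂ q.1 * h.1,
      (deriv b₃ q.1 + q.2.2 * deriv a q.1) * h.1 + h.2.1 + a q.1 * h.2.2) := by
    intro q h
    have t1 := ((dsnd1 q).sub_const s).add ((dP1 q.1).comp_hasFDerivAt q (dfst q))
    have t2 := ((dsnd2 q).sub_const r).add ((dP2 q.1).comp_hasFDerivAt q (dfst q))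
    have t3 := (((hb₃.differentiable hne q.1).hasDerivAt.comp_hasFDerivAt q (dfst q)).add
      (dsnd1 q)).add ((dsnd2 q).mul ((ha.differentiable hne q.1).hasDerivAt.comp_hasFDerivAt q (dfst q)))
    have t : HasFDerivAt φ _ q := t1.prodMk (t2.prodMk t3)
    rw [t.fderiv]
    simp
    ring
  have hinj : Function.Injective (fderiv ℝ φ (0, s, r)) := by
    rw [injective_iff_map_eq_zero]
    rintro ⟨h0, h1, h2⟩ hh
    rw [dφ] at hh
    simp only [Prod.mk_eq_zero] at hh ⊢
    obtain ⟨k1, k2, k3⟩ := hh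
    have : h0 = 0 := by
      refine (mul_eq_zero.1 ?_).resolve_left hc
      linear_combination k3 - k1 - a 0 * k2
    subst this
    refine ⟨rfl, by linarith, by linarith⟩
  let F : ℝ × ℝ × ℝ → E4 := fun p => γ p.1 + p.2.1 • X p.1 + p.2.2 • Y p.1
  have hFs : ContDiff ℝ ∞ F := by fun_prop
  have dF : ∀ q, deriv Y q.1 = a q.1 • deriv X q.1 → deriv γ q.1 =
      b₁ q.1 • X q.1 + b₂ q.1 • Y q.1 + b₃ q.1 • deriv X q.1 → ∀ h, fderiv ℝ F q h =
      (fderiv ℝ φ q h).1 • X q.1 + (fderiv ℝ φ q h).2.1 • Y q.1 +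
        ((φ q).2.2 * h.1) • deriv X q.1 := by
    intro q e1 e2 h
    have t1 := (hγ.differentiable hne q.1).hasDerivAt.hasFDerivAt.comp q (dfst q)
    have t2 := (dsnd1 q).smul ((hX.differentiable hne q.1).hasDerivAt.hasFDerivAt.comp q (dfst q))
    have t3 := (dsnd2 q).smul ((hY.differentiable hne q.1).hasDerivAt.hasFDerivAt.comp q (dfst q))
    have t : HasFDerivAt F _ q := (t1.add t2).add t3
    rw [t.fderiv, dφ]
    simp [e1, e2, φ]
    module
  obtain ⟨ψ, hψ0, hψs, hψl, hψr, hψb⟩ := locInv hφ (0, s, r) hinj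
  rw [hφp] at hψ0 hψs hψr hψb
  have hψc : Tendsto (fun x => (ψ x).1) (𝓝 0) (𝓝 0) := by
    have := hψs.self_of_nhds.continuousAt.tendsto
    rw [hψ0] at this
    exact (continuous_fst.tendsto _).comp this
  have hψd : ∀ᶠ x in 𝓝 0, ∀ h, fderiv ℝ φ (ψ x) (fderiv ℝ ψ x h) = h := by
    filter_upwards [hψs, hψr.eventually_nhds] with x h1 h2 h
    have t1 := (hφ.differentiable hne (ψ x)).hasFDerivAt.comp x (h1.differentiableAt hne).hasFDerivAt
    have t2 : HasFDerivAt (φ ∘ ψ) (ContinuousLinearMap.id ℝ _) x :=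
      (hasFDerivAt_id x).congr_of_eventuallyEq h2
    simpa using DFunLike.congr_fun (t1.unique t2) h
  let K : ℝ × ℝ × ℝ → E4 := fun x => F (ψ x)
  have hK : ∀ᶠ x in 𝓝 (0 : ℝ × ℝ × ℝ), ContDiffAt ℝ ∞ K x := by
    filter_upwards [hψs] with x hx
    exact hFs.contDiffAt.comp x hx
  have dK : ∀ᶠ x in 𝓝 (0 : ℝ × ℝ × ℝ), ∃ L : ℝ × ℝ × ℝ →L[ℝ] E4, HasFDerivAt K L x ∧
      ∀ h, L h = h.1 • X (ψ x).1 + h.2.1 • Y (ψ x).1 +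
        (x.2.2 * (fderiv ℝ ψ x h).1) • deriv X (ψ x).1 := by
    filter_upwards [hψs, hψd, hψr, hψc.eventually hY', hψc.eventually hγ'] with x h1 h2 h3 h4 h5
    refine ⟨_, (hFs.differentiable hne (ψ x)).hasFDerivAt.comp x
      (h1.differentiableAt hne).hasFDerivAt, fun h => ?_⟩
    rw [ContinuousLinearMap.comp_apply, dF _ h4 h5, h2, h3]
  have hw : ∀ᶠ x in 𝓝 (0 : ℝ × ℝ × ℝ), x.2.2 = 0 →
      HasDerivAt (fun w => K (x.1, x.2.1, w)) 0 0 := by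
    filter_upwards [dK] with x ⟨L, hL, hLf⟩ h0
    have hx0 : (x.1, x.2.1, (0:ℝ)) = x := by rw [← h0]
    rw [← hx0] at hL
    have := hL.comp_hasDerivAt (f := fun w : ℝ => (x.1, x.2.1, w)) (0:ℝ)
      ((hasDerivAt_const _ _).prodMk ((hasDerivAt_const _ _).prodMk (hasDerivAt_id (0:ℝ))))
    refine this.congr_deriv ?_
    rw [hLf, h0]; simp
  obtain ⟨L0, hL0, hL0f⟩ := dK.self_of_nhds
  have hx : HasDerivAt (fun u => K (u, 0, 0)) (X 0) 0 := by
    have := hL0.comp_hasDerivAt (f := fun w : ℝ => (w, 0, 0)) (0:ℝ)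
      ((hasDerivAt_id (0:ℝ)).prodMk ((hasDerivAt_const _ _).prodMk (hasDerivAt_const _ _)))
    refine this.congr_deriv ?_
    rw [hL0f, hψ0]; simp
  have hy : HasDerivAt (fun v => K (0, v, 0)) (Y 0) 0 := by
    have := hL0.comp_hasDerivAt (f := fun w : ℝ => (0, w, 0)) (0:ℝ)
      ((hasDerivAt_const _ _).prodMk ((hasDerivAt_id (0:ℝ)).prodMk (hasDerivAt_const _ _)))
    refine this.congr_deriv ?_
    rw [hL0f, hψ0]; simp
  have dl : ∀ w : ℝ, HasDerivAt (fun w : ℝ => ((0, 0, w) : ℝ × ℝ × ℝ)) (0, 0, 1) w := fun w =>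
    (hasDerivAt_const _ _).prodMk ((hasDerivAt_const _ _).prodMk (hasDerivAt_id w))
  have cl : Tendsto (fun w : ℝ => ((0, 0, w) : ℝ × ℝ × ℝ)) (𝓝 0) (𝓝 0) := (dl 0).continuousAt
  let T : ℝ → ℝ := fun w => (ψ (0, 0, w)).1
  let T' : ℝ → ℝ := fun w => (fderiv ℝ ψ (0, 0, w) (0, 0, 1)).1
  have hT0 : T 0 = 0 := by
    change (ψ 0).1 = 0
    rw [hψ0]
  have dT : HasDerivAt T (T' 0) 0 := by
    have h1 : HasFDerivAt ψ (fderiv ℝ ψ 0) ((fun w : ℝ => ((0, 0, w) : ℝ × ℝ × ℝ)) 0) :=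
      (hψs.self_of_nhds.differentiableAt hne).hasFDerivAt
    exact hasFDerivAt_fst.comp_hasDerivAt (0:ℝ) (h1.comp_hasDerivAt (0:ℝ) (dl 0))
  obtain ⟨T'', dT'⟩ : ∃ T'', HasDerivAt T' T'' 0 := by
    have h1 : DifferentiableAt ℝ (fderiv ℝ ψ) ((fun w : ℝ => ((0, 0, w) : ℝ × ℝ × ℝ)) 0) := by
      have : ContDiffAt ℝ 1 (fderiv ℝ ψ) 0 :=
        hψs.self_of_nhds.fderiv_right (m := 1) (by
          first
          | exact ENat.LEInfty.out
          | exact WithTop.coe_le_coe.2 (le_top : (1 + 1 : ℕ∞) ≤ ⊤))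
      exact this.differentiableAt (by simp)
    have h2 : DifferentiableAt ℝ T' 0 := by
      have h3 := h1.comp (0:ℝ) (dl 0).differentiableAt
      exact (h3.clm_apply (differentiableAt_const (c := ((0, 0, 1) : ℝ × ℝ × ℝ)))).fst
    exact ⟨_, h2.hasDerivAt⟩
  let m : ℝ → E4 := fun w => T' w • deriv X (T w)
  have hm : ∀ᶠ w in 𝓝 (0:ℝ), HasDerivAt (fun w => K (0, 0, w)) (w • m w) w := by
    filter_upwards [cl.eventually dK] with w ⟨L, hL, hLf⟩
    have := hL.comp_hasDerivAt (f := fun w : ℝ => (0, 0, w)) w (dl w)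
    refine this.congr_deriv ?_
    rw [hLf]
    simp [m, T, T', smul_smul]
  have hm' : HasDerivAt m (T' 0 • (T' 0 • deriv (deriv X) 0) + T'' • deriv X 0) 0 := by
    have h1 : HasDerivAt (deriv X) (deriv (deriv X) 0) (T 0) := by
      rw [hT0]; exact (hX1.differentiable hne 0).hasDerivAt
    have h2 := dT'.smul (h1.scomp (0:ℝ) dT)
    refine h2.congr_deriv ?_
    simp [hT0]
  have hT'0 : T' 0 ≠ 0 := by
    intro h
    have h1 := hψd.self_of_nhds (0, 0, 1)
    rw [hψ0, dφ] at h1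
    have h2 : (fderiv ℝ ψ 0 (0, 0, 1)).1 = 0 := h
    rw [h2] at h1
    simp only [Prod.mk.injEq, mul_zero, add_zero, zero_add] at h1
    obtain ⟨k1, k2, k3⟩ := h1
    rw [k1, k2] at k3
    simp at k3
  have hm0 : m 0 = T' 0 • deriv X 0 := by simp only [m, hT0]
  have hli : ∀ c0 c1 c2 c3 : ℝ, c0 • X 0 + c1 • Y 0 + c2 • m 0 +
      c3 • (T' 0 • (T' 0 • deriv (deriv X) 0) + T'' • deriv X 0) = 0 →
      c0 = 0 ∧ c1 = 0 ∧ c2 = 0 ∧ c3 = 0 := by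
    intro c0 c1 c2 c3 h
    have hv := Matrix.eq_zero_of_vecMul_eq_zero hdet
      (v := ![c0, c1, c2 * T' 0 + c3 * T'', c3 * T' 0 * T' 0]) (by
        rw [← h, hm0]
        ext i
        simp [Matrix.vecMul, dotProduct, Fin.sum_univ_four]
        ring)
    have q0 := congrFun hv 0
    have q1 := congrFun hv 1
    have q2 := congrFun hv 2
    have q3 := congrFun hv 3
    simp [hT'0] at q0 q1 q2 q3
    subst q3
    simp [hT'0] at q2
    exact ⟨q0, q1, q2, rfl⟩
  obtain ⟨Φ, hΦ, hΦ0, hΦe⟩ := normal_form hK hw hx hy hm hm' hli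
  have hK0 : K 0 = F (0, s, r) := by simp only [K, hψ0]
  rw [hK0] at hΦ hΦ0
  have hbij : Function.Bijective (fderiv ℝ φ (0, s, r)) :=
    ⟨hinj, LinearMap.surjective_of_injective
      (f := (fderiv ℝ φ (0, s, r)).toLinearMap) hinj⟩
  refine ⟨φ, Φ, ⟨hφ.contDiffAt, hbij⟩, hΦ, hφp, ?_, ?_⟩
  · refine hΦ0.trans ?_
    ext i; fin_cases i <;> simp
  · have cφ : Tendsto φ (𝓝 (0, s, r)) (𝓝 0) := by
      rw [← hφp]; exact hφ.continuous.tendsto _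
    filter_upwards [cφ.eventually hΦe, hψl] with q h1 h2
    have : K (φ q) = F q := by simp only [K, h2]
    rw [this] at h1
    exact h1

end

/-- A pseudo-non-degenerate two-ruled frontal which is a front at a singular point
`p = (0,s,r)` (i.e. `δ(0) ≠ 0`) is a cuspidal edge at `p` iff
`ra'(0) − a(0)b₂(0) − b₁(0) + b₃'(0) ≠ 0`. -/
theorem stmt13 (γ X Y : ℝ → E4) (a b₁ b₂ b₃ : ℝ → ℝ)
    (hγ : ContDiff ℝ (⊤ : ℕ∞) γ) (hX : ContDiff ℝ (⊤ : ℕ∞) X) (hY : ContDiff ℝ (⊤ : ℕ∞) Y)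
    (ha : ContDiff ℝ (⊤ : ℕ∞) a) (hb₁ : ContDiff ℝ (⊤ : ℕ∞) b₁) (hb₂ : ContDiff ℝ (⊤ : ℕ∞) b₂)
    (hb₃ : ContDiff ℝ (⊤ : ℕ∞) b₃)
    -- constrictively adapted director curves
    (hXunit : ∀ᶠ t in 𝓝 (0:ℝ), dot4 (X t) (X t) = 1)
    (hYunit : ∀ᶠ t in 𝓝 (0:ℝ), dot4 (Y t) (Y t) = 1)
    (hXY : ∀ᶠ t in 𝓝 (0:ℝ), dot4 (X t) (Y t) = 0)
    (hXY' : ∀ᶠ t in 𝓝 (0:ℝ), dot4 (X t) (deriv Y t) = 0)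
    -- normalization
    (hspan : ∀ᶠ t in 𝓝 (0:ℝ), LinearIndependent ℝ ![X t, Y t, deriv X t])
    (hX'unit : ∀ᶠ t in 𝓝 (0:ℝ), dot4 (deriv X t) (deriv X t) = 1)
    -- structure functions with b₄ ≡ 0 (two-ruled frontal)
    (hY' : ∀ᶠ t in 𝓝 (0:ℝ), deriv Y t = a t • deriv X t)
    (hγ' : ∀ᶠ t in 𝓝 (0:ℝ), deriv γ t =
      b₁ t • X t + b₂ t • Y t + b₃ t • deriv X t)
    (F : ℝ × ℝ × ℝ → E4)
    (hF : F = fun p => γ p.1 + p.2.1 • X p.1 + p.2.2 • Y p.1)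
    (δ : ℝ → ℝ)
    (hδ : δ = fun t => -det4 (X t) (Y t) (deriv X t) (deriv (deriv X) t))
    (s r : ℝ)
    -- p = (0,s,r) is a singular point and f is a front there
    (hsing : b₃ 0 + s + r * a 0 = 0)
    (hfront : δ 0 ≠ 0) :
    AEquivAt F (0, s, r) (fun q => ![q.1, q.2.1, q.2.2^2, q.2.2^3]) ↔
      r * deriv a 0 - a 0 * b₂ 0 - b₁ 0 + deriv b₃ 0 ≠ 0 := by
  subst hF
  constructor
  · exact only_if_part hγ hX hY ha hb₁ hb₂ hb₃ hY' hγ' s r hsing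
  · refine if_part hγ hX hY ha hb₁ hb₂ hb₃ hY' hγ' s r hsing ?_
    rw [hδ] at hfront
    exact fun h => hfront (by simp only [h, neg_zero])
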